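/- arXiv:1503.05326 — 2 statements merged into one kernel-verified Lean document; each statement's English description precedes it below -/
import Mathlib

section
/- Let W be the hyperoctahedral group of signed permutations of {1,...,n}, and let C be a conjugacy class of W with z cycles total, of which ν are negative, with negative cycle lengths λ₁ ≤ ⋯ ≤ λ_ν. Then the minimal Coxeter length (number of positive roots of type B_n sent to negative roots) of elements in C equals n + ν − z + 2·Σ_{i=1}^{ν−1} (ν − i)λ_i. -/
/-- A permutation of `Fin n × Bool` is a signed permutation if it commutes with
the sign flip `(i, s) ↦ (i, !s)` (thinking of `(i, false)` as `+i` and `(i, true)` as `-i`). -/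
def IsSignedPerm {n : ℕ} (w : Equiv.Perm (Fin n × Bool)) : Prop :=
  ∀ p : Fin n × Bool, w (p.1, !p.2) = ((w p).1, !(w p).2)

/-- The natural (left) action of a signed permutation on vectors in `ℤⁿ`. -/
def act {n : ℕ} (w : Equiv.Perm (Fin n × Bool)) (v : Fin n → ℤ) : Fin n → ℤ :=
  fun j => if (w⁻¹ (j, false)).2 then -v (w⁻¹ (j, false)).1 else v (w⁻¹ (j, false)).1

/-- The long positive roots `e_i ± e_j`, `i < j`, of type `B_n`. -/
def longPos (n : ℕ) : Set (Fin n → ℤ) :=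
  {v | ∃ i j : Fin n, i < j ∧
    (v = Pi.single i 1 + Pi.single j 1 ∨ v = Pi.single i 1 - Pi.single j 1)}

/-- The short positive roots `e_i` of type `B_n`. -/
def shortPos (n : ℕ) : Set (Fin n → ℤ) :=
  {v | ∃ i : Fin n, v = Pi.single i 1}

/-- All positive roots of type `B_n`. -/
def posRoots (n : ℕ) : Set (Fin n → ℤ) := longPos n ∪ shortPos n

/-- `Λ(w)`: the long positive roots sent to negative roots by `w`. -/
def Lam {n : ℕ} (w : Equiv.Perm (Fin n × Bool)) : Set (Fin n → ℤ) :=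
  {v ∈ longPos n | -(act w v) ∈ posRoots n}

/-- `Σ(w)`: the short positive roots sent to negative roots by `w`. -/
def Sig {n : ℕ} (w : Equiv.Perm (Fin n × Bool)) : Set (Fin n → ℤ) :=
  {v ∈ shortPos n | -(act w v) ∈ posRoots n}

/-- The Coxeter length of `w` in type `B_n`: the number of positive roots sent negative. -/
noncomputable def BLen {n : ℕ} (w : Equiv.Perm (Fin n × Bool)) : ℕ :=
  Set.ncard {v ∈ posRoots n | -(act w v) ∈ posRoots n}

/-- The sign–flip permutation, i.e. the longest element `w₀ = -1` of `B_n`. -/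
def negPerm (n : ℕ) : Equiv.Perm (Fin n × Bool) :=
  ⟨fun p => (p.1, !p.2), fun p => (p.1, !p.2),
    fun p => by cases p; simp, fun p => by cases p; simp⟩

/-- The vector `±e_i` attached to a signed index. -/
def signedUnit {n : ℕ} (p : Fin n × Bool) : Fin n → ℤ :=
  Pi.single p.1 (if p.2 then -1 else 1)

/-- The sum of the signed unit vectors of `p` and `q` has leading sign `b`
(`true` for negative). -/
def LeadSign {n : ℕ} (b : Bool) (p q : Fin n × Bool) : Prop :=
  (p.1 < q.1 ∧ p.2 = b) ∨ (q.1 < p.1 ∧ q.2 = b)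

/-- Indices `i` such that `e_i` is sent to a negative root. -/
def shortInv {n : ℕ} (w : Equiv.Perm (Fin n × Bool)) : Finset (Fin n) :=
  {i | (w (i, false)).2 = true}

open Classical in
/-- Triples `(i, j, s)` encoding the long positive roots `e_i ± e_j` sent to negative roots. -/
noncomputable def longInv {n : ℕ} (w : Equiv.Perm (Fin n × Bool)) :
    Finset (Fin n × Fin n × Bool) :=
  {x | x.1 < x.2.1 ∧ LeadSign true (w (x.1, false)) (w x.2)}

theorem mem_longInv {n : ℕ} {w : Equiv.Perm (Fin n × Bool)} {x : Fin n × Fin n × Bool} :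
    x ∈ longInv w ↔ x.1 < x.2.1 ∧ LeadSign true (w (x.1, false)) (w x.2) := by
  simp [longInv]

theorem LeadSign.symm {n : ℕ} {b : Bool} {p q : Fin n × Bool} (h : LeadSign b p q) :
    LeadSign b q p := Or.symm h

theorem signedUnit_apply {n : ℕ} (p : Fin n × Bool) (j : Fin n) :
    signedUnit p j = if j = p.1 then (if p.2 then -1 else 1) else 0 := by
  simp [signedUnit, Pi.single_apply]

theorem signedUnit_not {n : ℕ} (i : Fin n) (b : Bool) :
    signedUnit (i, !b) = -signedUnit (i, b) := by
  ext j
  cases b <;> simp [signedUnit_apply] <;> split_ifs <;> simp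

theorem act_add {n : ℕ} (w : Equiv.Perm (Fin n × Bool)) (u v : Fin n → ℤ) :
    act w (u + v) = act w u + act w v := by
  ext j
  simp only [act, Pi.add_apply]
  split_ifs <;> ring

theorem IsSignedPerm.apply_eq {n : ℕ} {w : Equiv.Perm (Fin n × Bool)} (hw : IsSignedPerm w)
    (i : Fin n) (b : Bool) :
    w (i, b) = ((w (i, false)).1, xor b (w (i, false)).2) := by
  cases b
  · simp
  · simpa using hw (i, false)

theorem IsSignedPerm.pow {n : ℕ} {w : Equiv.Perm (Fin n × Bool)} (hw : IsSignedPerm w)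
    (m : ℕ) : IsSignedPerm (w ^ m) := by
  induction m with
  | zero => intro p; simp
  | succ m ih =>
    intro p
    rw [pow_succ', Equiv.Perm.mul_apply, ih p, hw, Equiv.Perm.mul_apply]

theorem IsSignedPerm.fst_ne {n : ℕ} {w : Equiv.Perm (Fin n × Bool)} (hw : IsSignedPerm w)
    {p q : Fin n × Bool} (h : p.1 ≠ q.1) : (w p).1 ≠ (w q).1 := by
  intro heq
  by_cases hs : (w p).2 = (w q).2
  · exact h (congrArg Prod.fst (w.injective (Prod.ext heq hs)))
  · have h1 : w (q.1, !q.2) = w p := by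
      rw [hw q]
      refine Prod.ext heq.symm ?_
      simp only
      revert hs
      cases (w p).2 <;> cases (w q).2 <;> simp
    exact h (congrArg Prod.fst (w.injective h1)).symm

theorem act_signedUnit {n : ℕ} {w : Equiv.Perm (Fin n × Bool)} (hw : IsSignedPerm w)
    (p : Fin n × Bool) : act w (signedUnit p) = signedUnit (w p) := by
  ext j
  obtain ⟨r, hr⟩ : ∃ r, w⁻¹ (j, false) = r := ⟨_, rfl⟩
  have hr' : w r = (j, false) := by rw [← hr]; simp
  simp only [act, hr, signedUnit_apply]
  by_cases h : r.1 = p.1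
  · obtain ⟨i, b⟩ := p
    obtain ⟨k, d⟩ := r
    simp only at h
    subst h
    by_cases hbd : d = b
    · subst hbd
      rw [hr']
      cases d <;> simp
    · have : b = !d := by revert hbd; cases b <;> cases d <;> simp
      subst this
      have := hw (k, d)
      rw [hr'] at this
      simp only at this
      rw [this]
      cases d <;> simp
  · have h2 := hw.fst_ne h
    rw [hr'] at h2
    simp [h, h2]

theorem exists_leading_of_mem_posRoots {n : ℕ} {v : Fin n → ℤ} (hv : v ∈ posRoots n) :
    ∃ i, v i = 1 ∧ ∀ j < i, v j = 0 := by
  rcases hv with ⟨i, j, hij, rfl | rfl⟩ | ⟨i, rfl⟩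
  · refine ⟨i, by simp [hij.ne], fun k hk => ?_⟩
    simp [hk.ne, (hk.trans hij).ne]
  · refine ⟨i, by simp [hij.ne], fun k hk => ?_⟩
    simp [hk.ne, (hk.trans hij).ne]
  · exact ⟨i, by simp, fun k hk => by simp [hk.ne]⟩

theorem neg_notMem_posRoots {n : ℕ} {v : Fin n → ℤ} (hv : v ∈ posRoots n) :
    -v ∉ posRoots n := by
  intro h
  obtain ⟨i, hi, hi'⟩ := exists_leading_of_mem_posRoots hv
  obtain ⟨j, hj, hj'⟩ := exists_leading_of_mem_posRoots h
  rcases lt_trichotomy i j with hij | rfl | hij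
  · have := hj' i hij
    simp [hi] at this
  · simp [hi] at hj
  · have := hi' j hij
    simp [this] at hj

theorem signedUnit_false_mem_posRoots {n : ℕ} (i : Fin n) :
    signedUnit (i, false) ∈ posRoots n :=
  Or.inr ⟨i, by simp [signedUnit]⟩

theorem signedUnit_add_mem_longPos {n : ℕ} {i : Fin n} {q : Fin n × Bool} (h : i < q.1) :
    signedUnit (i, false) + signedUnit q ∈ longPos n := by
  obtain ⟨j, b⟩ := q
  refine ⟨i, j, h, ?_⟩
  cases b
  · left; simp [signedUnit]
  · right
    rw [sub_eq_add_neg, ← Pi.single_neg]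
    simp [signedUnit]

theorem LeadSign.add_mem_posRoots {n : ℕ} {p q : Fin n × Bool} (h : LeadSign false p q) :
    signedUnit p + signedUnit q ∈ posRoots n := by
  obtain ⟨i, a⟩ := p
  obtain ⟨j, b⟩ := q
  rcases h with ⟨h, rfl⟩ | ⟨h, rfl⟩
  · exact Or.inl (signedUnit_add_mem_longPos h)
  · rw [add_comm]
    exact Or.inl (signedUnit_add_mem_longPos h)

theorem neg_signedUnit_mem_posRoots_iff {n : ℕ} (p : Fin n × Bool) :
    -signedUnit p ∈ posRoots n ↔ p.2 = true := by
  obtain ⟨i, b⟩ := p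
  cases b
  · simpa using neg_notMem_posRoots (signedUnit_false_mem_posRoots i)
  · simpa [← signedUnit_not] using signedUnit_false_mem_posRoots i

theorem neg_add_mem_posRoots_iff {n : ℕ} {p q : Fin n × Bool} (h : p.1 ≠ q.1) :
    -(signedUnit p + signedUnit q) ∈ posRoots n ↔ LeadSign true p q := by
  constructor
  · intro hm
    by_contra hl
    refine neg_notMem_posRoots (LeadSign.add_mem_posRoots ?_) hm
    unfold LeadSign at hl ⊢
    grind
  · intro hl
    rw [neg_add, ← signedUnit_not, ← signedUnit_not]
    refine LeadSign.add_mem_posRoots ?_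
    unfold LeadSign at hl ⊢
    grind

theorem signedUnit_add_inj {n : ℕ} {i i' : Fin n} {q q' : Fin n × Bool} (h : i < q.1)
    (h' : i' < q'.1)
    (heq : signedUnit (i, false) + signedUnit q = signedUnit (i', false) + signedUnit q') :
    i = i' ∧ q = q' := by
  have h1 := congrFun heq i
  have h2 := congrFun heq i'
  have h3 := congrFun heq q.1
  have h4 := congrFun heq q'.1
  obtain ⟨j, b⟩ := q
  obtain ⟨j', b'⟩ := q'
  simp only [Pi.add_apply, signedUnit_apply] at h1 h2 h3 h4
  grind

theorem BLen_eq_card {n : ℕ} {w : Equiv.Perm (Fin n × Bool)} (hw : IsSignedPerm w) :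
    BLen w = (shortInv w).card + (longInv w).card := by
  have hset : {v ∈ posRoots n | -(act w v) ∈ posRoots n} =
      (fun i : Fin n => signedUnit (i, false)) '' (shortInv w : Set (Fin n)) ∪
      (fun x : Fin n × Fin n × Bool => signedUnit (x.1, false) + signedUnit x.2) ''
        (longInv w : Set (Fin n × Fin n × Bool)) := by
    ext v
    simp only [Set.mem_ofPred_eq, Set.mem_union, Set.mem_image, Finset.mem_coe, mem_longInv]
    constructor
    · rintro ⟨hv | ⟨i, rfl⟩, hneg⟩
      · right
        obtain ⟨i, q, hq, rfl⟩ : ∃ (i : Fin n) (q : Fin n × Bool), i < q.1 ∧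
            v = signedUnit (i, false) + signedUnit q := by
          obtain ⟨i, j, hij, rfl | rfl⟩ := hv
          · exact ⟨i, (j, false), hij, by simp [signedUnit]⟩
          · exact ⟨i, (j, true), hij, by simp [signedUnit, sub_eq_add_neg, Pi.single_neg]⟩
        rw [act_add, act_signedUnit hw, act_signedUnit hw,
          neg_add_mem_posRoots_iff (hw.fst_ne hq.ne)] at hneg
        exact ⟨(i, q), ⟨hq, hneg⟩, rfl⟩
      · left
        have hs : (Pi.single i 1 : Fin n → ℤ) = signedUnit (i, false) := by simp [signedUnit]
        rw [hs, act_signedUnit hw, neg_signedUnit_mem_posRoots_iff] at hneg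
        exact ⟨i, by simpa [shortInv] using hneg, hs.symm⟩
    · rintro (⟨i, hi, rfl⟩ | ⟨⟨i, q⟩, ⟨hq, hl⟩, rfl⟩)
      · refine ⟨signedUnit_false_mem_posRoots i, ?_⟩
        rw [act_signedUnit hw, neg_signedUnit_mem_posRoots_iff]
        simpa [shortInv] using hi
      · refine ⟨Or.inl (signedUnit_add_mem_longPos hq), ?_⟩
        rw [act_add, act_signedUnit hw, act_signedUnit hw,
          neg_add_mem_posRoots_iff (hw.fst_ne hq.ne)]
        exact hl
  rw [BLen, hset, Set.ncard_union_eq, Set.InjOn.ncard_image, Set.InjOn.ncard_image,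
    Set.ncard_coe_finset, Set.ncard_coe_finset]
  · rintro ⟨i, q⟩ hx ⟨i', q'⟩ hx' heq
    obtain ⟨rfl, rfl⟩ := signedUnit_add_inj (mem_longInv.1 hx).1 (mem_longInv.1 hx').1 heq
    rfl
  · intro i _ j _ heq
    have := congrFun heq i
    by_contra hne
    simp [signedUnit_apply, hne] at this
  · rw [Set.disjoint_left]
    rintro _ ⟨k, _, rfl⟩ ⟨⟨i, j, b⟩, hx, heq⟩
    have hij := (mem_longInv.1 hx).1
    have h1 := congrFun heq i
    have h2 := congrFun heq j
    simp only [Pi.add_apply, signedUnit_apply] at h1 h2 hij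
    grind

/-- The signed permutation `w` preserves the coloring `c` of the indices, and its
underlying permutation is transitive on each color class. -/
structure IsCycleColoring {n : ℕ} (w : Equiv.Perm (Fin n × Bool)) (c : Fin n → ℕ) : Prop where
  signed : IsSignedPerm w
  color_apply : ∀ i : Fin n, c (w (i, false)).1 = c i
  transitive : ∀ i j : Fin n, c i = c j → ∃ m : ℕ, ((w ^ m) (i, false)).1 = j

/-- The indices of color `t`. -/
def colorClass {n : ℕ} (c : Fin n → ℕ) (t : ℕ) : Finset (Fin n) := {i | c i = t}

theorem mem_colorClass {n : ℕ} {c : Fin n → ℕ} {t : ℕ} {i : Fin n} :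
    i ∈ colorClass c t ↔ c i = t := by
  simp [colorClass]

theorem ncard_color_eq {n : ℕ} (c : Fin n → ℕ) (t : ℕ) :
    Set.ncard {i : Fin n | c i = t} = (colorClass c t).card := by
  rw [← Set.ncard_coe_finset]
  congr 1
  ext i
  simp [colorClass]

theorem ncard_color_inter_eq {n : ℕ} (w : Equiv.Perm (Fin n × Bool)) (c : Fin n → ℕ) (t : ℕ) :
    Set.ncard {i : Fin n | c i = t ∧ (w (i, false)).2 = true} =
      (colorClass c t ∩ shortInv w).card := by
  rw [← Set.ncard_coe_finset]
  congr 1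
  ext i
  simp [colorClass, shortInv]

theorem le_card_shortInv_of_odd {n : ℕ} {w : Equiv.Perm (Fin n × Bool)} {c : Fin n → ℕ} {ν : ℕ}
    (hodd : ∀ t < ν, Odd (colorClass c t ∩ shortInv w).card) : ν ≤ (shortInv w).card := by
  calc ν = (Finset.range ν).card := (Finset.card_range ν).symm
    _ ≤ ((shortInv w).image c).card := by
        refine Finset.card_le_card fun t ht => ?_
        obtain ⟨i, hi⟩ := Finset.card_pos.1 (hodd t (Finset.mem_range.1 ht)).pos
        rw [Finset.mem_inter, mem_colorClass] at hi
        exact Finset.mem_image.2 ⟨i, hi.2, hi.1⟩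
    _ ≤ _ := Finset.card_image_le

/-- Normal form `(i, j, s)`, with `i < j` for distinct indices, of an unordered pair of signed
indices of positive leading sign. -/
def normTriple {n : ℕ} (p q : Fin n × Bool) : Fin n × Fin n × Bool :=
  if p.1 < q.1 then (p.1, q) else (q.1, p)

theorem normTriple_inj {n : ℕ} {p q p' q' : Fin n × Bool} (h : LeadSign false p q)
    (h' : LeadSign false p' q') (heq : normTriple p q = normTriple p' q') :
    (p = p' ∧ q = q') ∨ (p = q' ∧ q = p') := by
  unfold normTriple LeadSign at *
  obtain ⟨i, a⟩ := p
  obtain ⟨j, b⟩ := q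
  obtain ⟨i', a'⟩ := p'
  obtain ⟨j', b'⟩ := q'
  grind

theorem normTriple_mem_longInv {n : ℕ} {w : Equiv.Perm (Fin n × Bool)} {p q : Fin n × Bool}
    (h : LeadSign false p q) (h' : LeadSign true (w p) (w q)) : normTriple p q ∈ longInv w := by
  rw [mem_longInv]
  obtain ⟨i, a⟩ := p
  obtain ⟨j, b⟩ := q
  rcases h with ⟨h, ha⟩ | ⟨h, hb⟩
  · simp only at h ha
    subst ha
    simpa [normTriple, h] using h'
  · simp only at h hb
    subst hb
    simpa [normTriple, h, h.not_gt] using h'.symm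

theorem IsSignedPerm.apply_xor {n : ℕ} {w : Equiv.Perm (Fin n × Bool)} (hw : IsSignedPerm w)
    (p : Fin n × Bool) (b : Bool) : w (p.1, xor b p.2) = ((w p).1, xor b (w p).2) := by
  cases b
  · simp
  · simpa using hw p

namespace IsCycleColoring

variable {n : ℕ} {w : Equiv.Perm (Fin n × Bool)} {c : Fin n → ℕ}

theorem color_pow (h : IsCycleColoring w c) (s : ℕ) (p : Fin n × Bool) :
    c ((w ^ s) p).1 = c p.1 := by
  induction s with
  | zero => simp
  | succ s ih =>
    rw [pow_succ', Equiv.Perm.mul_apply, ← ih]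
    obtain ⟨i, b⟩ := (w ^ s) p
    rw [h.signed.apply_eq, h.color_apply]

theorem fst_pow (h : IsCycleColoring w c) (s : ℕ) (p : Fin n × Bool) :
    ((w ^ s) p).1 = (fun j => (w (j, false)).1)^[s] p.1 := by
  induction s with
  | zero => simp
  | succ s ih =>
    rw [pow_succ', Equiv.Perm.mul_apply, Function.iterate_succ_apply', ← ih]
    obtain ⟨i, b⟩ := (w ^ s) p
    rw [h.signed.apply_eq]

theorem card_colorClass_eq_minimalPeriod_and_image (h : IsCycleColoring w c) (i : Fin n) :
    (colorClass c (c i)).card = Function.minimalPeriod (fun j => (w (j, false)).1) i ∧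
    (Finset.range (colorClass c (c i)).card).image (fun s => ((w ^ s) (i, false)).1) =
      colorClass c (c i) := by
  set f : Fin n → Fin n := fun j => (w (j, false)).1 with hf
  have hpos : 0 < Function.minimalPeriod f i := by
    obtain ⟨m, hm⟩ := h.transitive (f i) i (h.color_apply i)
    rw [h.fst_pow] at hm
    exact Function.IsPeriodicPt.minimalPeriod_pos (Nat.succ_pos m) hm
  have himage : (Finset.range (Function.minimalPeriod f i)).image
      (fun s => ((w ^ s) (i, false)).1) = colorClass c (c i) := by
    ext j
    simp only [Finset.mem_image, Finset.mem_range, mem_colorClass]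
    constructor
    · rintro ⟨s, -, rfl⟩
      rw [h.color_pow]
    · intro hj
      obtain ⟨m, hm⟩ := h.transitive i j hj.symm
      refine ⟨m % Function.minimalPeriod f i, Nat.mod_lt _ hpos, ?_⟩
      rw [← hm, h.fst_pow, h.fst_pow]
      exact Function.iterate_mod_minimalPeriod_eq
  have hcard : (colorClass c (c i)).card = Function.minimalPeriod f i := by
    rw [← himage, Finset.card_image_of_injOn, Finset.card_range]
    intro s hs t ht heq
    simp only [h.fst_pow] at heq
    exact Function.iterate_injOn_Iio_minimalPeriod (by simpa using hs) (by simpa using ht) heq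
  exact ⟨hcard, by rw [hcard, himage]⟩

theorem pow_injOn (h : IsCycleColoring w c) (p : Fin n × Bool) {s t : ℕ}
    (hs : s < (colorClass c (c p.1)).card) (ht : t < (colorClass c (c p.1)).card)
    (heq : ((w ^ s) p).1 = ((w ^ t) p).1) : s = t := by
  rw [(h.card_colorClass_eq_minimalPeriod_and_image p.1).1] at hs ht
  rw [h.fst_pow, h.fst_pow] at heq
  exact Function.iterate_injOn_Iio_minimalPeriod hs ht heq

theorem snd_pow (h : IsCycleColoring w c) (i : Fin n) (s : ℕ) :
    ((w ^ s) (i, false)).2 =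
      decide (Odd ((Finset.range s).filter
        (fun r => ((w ^ r) (i, false)).1 ∈ shortInv w)).card) := by
  induction s with
  | zero => simp
  | succ s ih =>
    rw [pow_succ', Equiv.Perm.mul_apply, Finset.range_add_one, Finset.filter_insert]
    obtain ⟨⟨j, b⟩, hjb⟩ : ∃ q, (w ^ s) (i, false) = q := ⟨_, rfl⟩
    rw [hjb] at ih ⊢
    rw [h.signed.apply_eq]
    simp only at ih ⊢
    rw [ih]
    by_cases hj : (w (j, false)).2 = true
    · rw [if_pos (by simpa [shortInv] using hj), Finset.card_insert_of_notMem (by simp), hj]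
      simp [Nat.odd_add_one, -Nat.not_odd_iff_even]
    · rw [if_neg (by simpa [shortInv] using hj)]
      simp [hj]

theorem pow_card (h : IsCycleColoring w c) (i : Fin n) :
    (w ^ (colorClass c (c i)).card) (i, false) =
      (i, decide (Odd (colorClass c (c i) ∩ shortInv w).card)) := by
  obtain ⟨hper, himage⟩ := h.card_colorClass_eq_minimalPeriod_and_image i
  refine Prod.ext ?_ ?_
  · rw [h.fst_pow, hper]
    exact Function.iterate_minimalPeriod
  · rw [h.snd_pow]
    simp only
    congr 2
    conv_rhs => rw [← himage, ← Finset.filter_mem_eq_inter, Finset.filter_image]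
    rw [Finset.card_image_of_injOn]
    intro s hs t ht heq
    simp only [Finset.coe_filter, Finset.mem_range] at hs ht
    exact h.pow_injOn (i, false) hs.1 ht.1 heq

theorem exists_sign_change {p q : Fin n × Bool} (h : IsCycleColoring w c) {T : ℕ}
    (h0 : LeadSign false p q) (hT : LeadSign true ((w ^ T) p) ((w ^ T) q)) :
    ∃ t < T, LeadSign false ((w ^ t) p) ((w ^ t) q) ∧
      normTriple ((w ^ t) p) ((w ^ t) q) ∈ longInv w := by
  have hne : p.1 ≠ q.1 := by
    rcases h0 with h0 | h0
    · exact h0.1.ne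
    · exact h0.1.ne'
  induction T with
  | zero =>
    unfold LeadSign at h0 hT
    simp only [pow_zero, Equiv.Perm.coe_one, id_eq] at hT
    grind
  | succ T ih =>
    by_cases hneg : LeadSign true ((w ^ T) p) ((w ^ T) q)
    · obtain ⟨t, ht, h'⟩ := ih hneg
      exact ⟨t, by omega, h'⟩
    · have hTne := (h.signed.pow T).fst_ne hne
      have hpos : LeadSign false ((w ^ T) p) ((w ^ T) q) := by
        unfold LeadSign at hneg ⊢
        grind
      refine ⟨T, by omega, hpos, normTriple_mem_longInv hpos ?_⟩
      simpa [pow_succ'] using hT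

/-- Long inversions supported on a single cycle. -/
theorem card_sub_one_le (h : IsCycleColoring w c) (t : ℕ) :
    (colorClass c t).card - 1 ≤
      ((longInv w).filter (fun x => c x.1 = t ∧ c x.2.1 = t)).card := by
  rcases (colorClass c t).eq_empty_or_nonempty with hemp | hne
  · simp [hemp]
  obtain ⟨m, hm, hmin⟩ := Finset.exists_min_image _ id hne
  rw [mem_colorClass] at hm
  subst hm
  simp only [mem_colorClass, id] at hmin
  set a := (colorClass c (c m)).card with ha
  set ε := decide (Odd (colorClass c (c m) ∩ shortInv w).card)
  have hpow : (w ^ a) (m, false) = (m, ε) := h.pow_card m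
  have hlt : ∀ k, 1 ≤ k → k < a → m < ((w ^ k) (m, false)).1 := by
    intro k hk hka
    refine lt_of_le_of_ne (hmin _ (h.color_pow k (m, false))) fun he => ?_
    have := h.pow_injOn (m, false) (s := 0) (t := k) (by simp only; omega) hka (by simpa using he)
    omega
  obtain ⟨q, hq⟩ : ∃ q : ℕ → Fin n × Bool,
      ∀ k, q k = (((w ^ k) (m, false)).1, xor (!ε) ((w ^ k) (m, false)).2) := ⟨_, fun _ => rfl⟩
  have hpowq : ∀ s k, (w ^ s) (q k) =
      (((w ^ (s + k)) (m, false)).1, xor (!ε) ((w ^ (s + k)) (m, false)).2) := by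
    intro s k
    rw [hq, (h.signed.pow s).apply_xor, pow_add, Equiv.Perm.mul_apply]
  have key : ∀ k, 1 ≤ k → k < a → ∃ s < a - k,
      LeadSign false ((w ^ s) (m, false)) ((w ^ s) (q k)) ∧
      normTriple ((w ^ s) (m, false)) ((w ^ s) (q k)) ∈ longInv w := by
    intro k hk hka
    refine h.exists_sign_change (Or.inl ⟨by simpa [hq] using hlt k hk hka, rfl⟩) ?_
    rw [hpowq, Nat.sub_add_cancel hka.le, hpow]
    refine Or.inr ⟨hlt _ (by omega) (by omega), by simp⟩
  choose! s hs hlead hmem using key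
  rw [← Nat.card_Ico 1 a]
  refine Finset.card_le_card_of_injOn
    (fun k => normTriple ((w ^ s k) (m, false)) ((w ^ s k) (q k))) ?_ ?_
  · intro k hk
    obtain ⟨hk1, hka⟩ := Finset.mem_Ico.1 hk
    rw [Finset.mem_coe, Finset.mem_filter]
    refine ⟨hmem k hk1 hka, ?_⟩
    have h1 := h.color_pow (s k) (m, false)
    have h2 : c ((w ^ s k) (q k)).1 = c m := by
      rw [hpowq]
      exact h.color_pow _ (m, false)
    simp only [normTriple]
    split_ifs
    · exact ⟨h1, h2⟩
    · exact ⟨h2, h1⟩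
  · intro k hk l hl heq
    obtain ⟨hk1, hka⟩ := Finset.mem_Ico.1 hk
    obtain ⟨hl1, hla⟩ := Finset.mem_Ico.1 hl
    have hsk := hs k hk1 hka
    have hsl := hs l hl1 hla
    have hinj : ∀ {r r' : ℕ}, r < a → r' < a →
        ((w ^ r) (m, false)).1 = ((w ^ r') (m, false)).1 → r = r' :=
      fun hr hr' => h.pow_injOn (m, false) hr hr'
    rcases normTriple_inj (hlead k hk1 hka) (hlead l hl1 hla) heq with ⟨h1, h2⟩ | ⟨h1, h2⟩
    · rw [hpowq, hpowq] at h2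
      have e1 := hinj (by omega) (by omega) (congrArg Prod.fst h1 :)
      have e2 := hinj (r := s k + k) (r' := s l + l) (by omega) (by omega)
        (congrArg Prod.fst h2 :)
      omega
    · rw [hpowq] at h1 h2
      have e1 := hinj (r := s k) (r' := s l + l) (by omega) (by omega) (congrArg Prod.fst h1 :)
      have e2 := hinj (r := s k + k) (r' := s l) (by omega) (by omega) (congrArg Prod.fst h2 :)
      omega

/-- Long inversions supported on two cycles, of which the one containing the smallest index
is negative. -/
theorem two_mul_card_le_of_min (h : IsCycleColoring w c) {t u : ℕ} (htu : t ≠ u) {m : Fin n}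
    (hm : c m = t) (hmin : ∀ j, c j = u → m ≤ j)
    (hodd : Odd (colorClass c t ∩ shortInv w).card) :
    2 * (colorClass c u).card ≤
      ((longInv w).filter
        (fun x => (c x.1 = t ∧ c x.2.1 = u) ∨ (c x.1 = u ∧ c x.2.1 = t))).card := by
  subst hm
  set a := (colorClass c (c m)).card with ha
  have hpow : (w ^ a) (m, false) = (m, true) := by rw [h.pow_card, decide_eq_true hodd]
  have key : ∀ q : Fin n × Bool, c q.1 = u → ∃ s < a,
      LeadSign false ((w ^ s) (m, false)) ((w ^ s) q) ∧
      normTriple ((w ^ s) (m, false)) ((w ^ s) q) ∈ longInv w := by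
    intro q hq
    have hlt : ∀ r : Fin n × Bool, c r.1 = u → m < r.1 := fun r hr =>
      lt_of_le_of_ne (hmin _ hr) fun he => htu (by rw [he, hr])
    refine h.exists_sign_change (Or.inl ⟨hlt q hq, rfl⟩) ?_
    rw [hpow]
    exact Or.inl ⟨hlt _ (by rw [h.color_pow, hq]), rfl⟩
  choose! s hs hlead hmem using key
  have hcard : 2 * (colorClass c u).card =
      (colorClass c u ×ˢ (Finset.univ : Finset Bool)).card := by
    rw [Finset.card_product, Finset.card_univ, Fintype.card_bool, mul_comm]
  rw [hcard]
  refine Finset.card_le_card_of_injOn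
    (fun q => normTriple ((w ^ s q) (m, false)) ((w ^ s q) q)) ?_ ?_
  · intro q hq
    have hq' : c q.1 = u := by simpa [mem_colorClass] using hq
    rw [Finset.mem_coe, Finset.mem_filter]
    refine ⟨hmem q hq', ?_⟩
    have h1 := h.color_pow (s q) (m, false)
    have h2 := h.color_pow (s q) q
    simp only [normTriple]
    split_ifs
    · exact Or.inl ⟨h1, h2.trans hq'⟩
    · exact Or.inr ⟨h2.trans hq', h1⟩
  · intro q hq q' hq' heq
    replace hq : c q.1 = u := by simpa [mem_colorClass] using hq
    replace hq' : c q'.1 = u := by simpa [mem_colorClass] using hq'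
    rcases normTriple_inj (hlead q hq) (hlead q' hq') heq with ⟨h1, h2⟩ | ⟨h1, -⟩
    · have hst : s q = s q' :=
        h.pow_injOn (m, false) (hs q hq) (hs q' hq') (congrArg Prod.fst h1)
      rw [hst] at h2
      exact (w ^ s q').injective h2
    · have h3 := congrArg (fun r : Fin n × Bool => c r.1) h1
      simp only [h.color_pow] at h3
      exact absurd (h3.trans hq') htu

theorem two_mul_min_le (h : IsCycleColoring w c) {t u : ℕ} (htu : t ≠ u)
    (ht : Odd (colorClass c t ∩ shortInv w).card) (hu : Odd (colorClass c u ∩ shortInv w).card) :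
    2 * min (colorClass c t).card (colorClass c u).card ≤
      ((longInv w).filter
        (fun x => (c x.1 = t ∧ c x.2.1 = u) ∨ (c x.1 = u ∧ c x.2.1 = t))).card := by
  have hne : (colorClass c t ∪ colorClass c u).Nonempty :=
    (Finset.card_pos.1 ht.pos).mono (Finset.inter_subset_left.trans Finset.subset_union_left)
  obtain ⟨m, hm, hmin⟩ := Finset.exists_min_image _ id hne
  simp only [Finset.mem_union, mem_colorClass, id] at hm hmin
  rcases hm with hm | hm
  · have := h.two_mul_card_le_of_min htu hm (fun j hj => hmin j (Or.inr hj)) ht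
    omega
  · have := h.two_mul_card_le_of_min htu.symm hm (fun j hj => hmin j (Or.inl hj)) hu
    simp only [or_comm] at this ⊢
    omega

theorem sum_le_card_longInv (h : IsCycleColoring w c) (z : ℕ) {ν : ℕ}
    (hodd : ∀ t < ν, Odd (colorClass c t ∩ shortInv w).card)
    (hsort : ∀ s t, s ≤ t → t < ν → (colorClass c s).card ≤ (colorClass c t).card) :
    ∑ t ∈ Finset.range z, ((colorClass c t).card - 1) +
      ∑ u ∈ Finset.range ν, ∑ t ∈ Finset.range u, 2 * (colorClass c t).card ≤
      (longInv w).card := by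
  rw [← Finset.card_filter_add_card_filter_not (s := longInv w) (fun x => c x.1 = c x.2.1)]
  refine add_le_add ?_ ?_
  · calc _ ≤ ∑ t ∈ Finset.range z,
          (((longInv w).filter (fun x => c x.1 = c x.2.1)).filter (fun x => c x.1 = t)).card := by
          refine Finset.sum_le_sum fun t _ => (h.card_sub_one_le t).trans (Finset.card_le_card ?_)
          intro x hx
          simp only [Finset.mem_filter] at hx ⊢
          exact ⟨⟨hx.1, hx.2.1.trans hx.2.2.symm⟩, hx.2.1⟩
      _ ≤ _ := by
          rw [Finset.sum_card_fiberwise_eq_card_filter]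
          exact Finset.card_filter_le _ _
  · rw [Finset.sum_sigma']
    calc _ ≤ ∑ y ∈ (Finset.range ν).sigma (fun u => Finset.range u),
          (((longInv w).filter (fun x => ¬ c x.1 = c x.2.1)).filter
            (fun x => (⟨max (c x.1) (c x.2.1), min (c x.1) (c x.2.1)⟩ : Σ _ : ℕ, ℕ) = y)).card := by
          refine Finset.sum_le_sum fun ⟨u, t⟩ hy => ?_
          simp only [Finset.mem_sigma, Finset.mem_range] at hy
          have hle := h.two_mul_min_le hy.2.ne (hodd t (hy.2.trans hy.1)) (hodd u hy.1)
          rw [min_eq_left (hsort t u hy.2.le hy.1)] at hle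
          refine hle.trans (Finset.card_le_card ?_)
          intro x hx
          simp only [Finset.mem_filter, Sigma.mk.injEq, heq_eq_eq] at hx ⊢
          obtain ⟨hx, hx'⟩ := hx
          exact ⟨⟨hx, by omega⟩, by omega, by omega⟩
      _ ≤ _ := by
          rw [Finset.sum_card_fiberwise_eq_card_filter]
          exact Finset.card_filter_le _ _

end IsCycleColoring

theorem sum_range_sum_range_eq (f : ℕ → ℕ) (ν : ℕ) :
    ∑ u ∈ Finset.range ν, ∑ t ∈ Finset.range u, f t =
      ∑ j ∈ Finset.range (ν - 1), (ν - 1 - j) * f j := by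
  cases ν with
  | zero => simp
  | succ ν =>
    rw [Nat.add_sub_cancel]
    induction ν with
    | zero => simp
    | succ ν ih =>
      rw [Finset.sum_range_succ, ih, Finset.sum_range_succ _ ν, ← add_assoc,
        ← Finset.sum_add_distrib, Finset.sum_range_succ _ ν]
      congr 1
      · refine Finset.sum_congr rfl fun j hj => ?_
        have : ν + 1 - j = ν - j + 1 := by have := Finset.mem_range.1 hj; omega
        rw [this, add_mul, one_mul]
      · simp

theorem sum_sub_one_add {z : ℕ} {lam : ℕ → ℕ} (h : ∀ t, t < z → 1 ≤ lam t) :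
    ∑ t ∈ Finset.range z, (lam t - 1) + z = ∑ t ∈ Finset.range z, lam t := by
  calc _ = ∑ t ∈ Finset.range z, (lam t - 1) + ∑ t ∈ Finset.range z, 1 := by simp
    _ = _ := by
      rw [← Finset.sum_add_distrib]
      exact Finset.sum_congr rfl fun t ht => Nat.sub_add_cancel (h t (Finset.mem_range.1 ht))

/-- The signed permutation `e_i ↦ ± e_{σ i}` with a minus sign when `g i` is true. -/
def signedPerm {n : ℕ} (σ : Equiv.Perm (Fin n)) (g : Fin n → Bool) :
    Equiv.Perm (Fin n × Bool) where
  toFun p := (σ p.1, xor p.2 (g p.1))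
  invFun p := (σ.symm p.1, xor p.2 (g (σ.symm p.1)))
  left_inv p := by simp
  right_inv p := by simp

theorem signedPerm_apply {n : ℕ} (σ : Equiv.Perm (Fin n)) (g : Fin n → Bool)
    (p : Fin n × Bool) : signedPerm σ g p = (σ p.1, xor p.2 (g p.1)) := rfl

theorem isSignedPerm_signedPerm {n : ℕ} (σ : Equiv.Perm (Fin n)) (g : Fin n → Bool) :
    IsSignedPerm (signedPerm σ g) := fun p => by simp [signedPerm_apply]

theorem signedPerm_pow_fst {n : ℕ} (σ : Equiv.Perm (Fin n)) (g : Fin n → Bool) (m : ℕ)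
    (p : Fin n × Bool) : ((signedPerm σ g ^ m) p).1 = (σ ^ m) p.1 := by
  induction m with
  | zero => simp
  | succ m ih => rw [pow_succ', pow_succ', Equiv.Perm.mul_apply, Equiv.Perm.mul_apply, ← ih,
      signedPerm_apply]

/-- A decomposition of `Fin n` into consecutive intervals of lengths `lam (z-1), …, lam 0`:
the index `i` is at position `pos i` of the interval of color `c i`. -/
structure IsBlockDecomposition {n : ℕ} (z : ℕ) (lam : ℕ → ℕ) (c pos : Fin n → ℕ) : Prop where
  color_lt : ∀ i, c i < z
  pos_lt : ∀ i, pos i < lam (c i)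
  ext : ∀ i j, c i = c j → pos i = pos j → i = j
  exists_eq : ∀ t x, t < z → x < lam t → ∃ i, c i = t ∧ pos i = x
  lt_iff : ∀ i j, i < j ↔ c j < c i ∨ (c i = c j ∧ pos i < pos j)

theorem exists_isBlockDecomposition {n z : ℕ} {lam : ℕ → ℕ}
    (hsum : ∑ t ∈ Finset.range z, lam t = n) :
    ∃ c pos : Fin n → ℕ, IsBlockDecomposition z lam c pos := by
  classical
  let key : (Σ _ : ℕ, ℕ) → ℕᵒᵈ ×ₗ ℕ := fun y => toLex (OrderDual.toDual y.1, y.2)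
  have hkey : Function.Injective key := by
    rintro ⟨t, x⟩ ⟨t', x'⟩ h
    have h' := Prod.mk.inj (toLex.injective h)
    obtain ⟨h1, h2⟩ := h'
    have h1 := OrderDual.toDual.injective h1
    simp only at h1 h2
    subst h1 h2
    rfl
  let T : Finset (ℕᵒᵈ ×ₗ ℕ) :=
    ((Finset.range z).sigma (fun t => Finset.range (lam t))).image key
  have hT : T.card = n := by
    rw [Finset.card_image_of_injective _ hkey, Finset.card_sigma]
    simpa using hsum
  let e := T.orderIsoOfFin hT
  have hmem : ∀ i, ∃ t x, t < z ∧ x < lam t ∧ (e i : ℕᵒᵈ ×ₗ ℕ) = key ⟨t, x⟩ := by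
    intro i
    obtain ⟨⟨t, x⟩, hy, hyi⟩ := Finset.mem_image.1 (e i).2
    simp only [Finset.mem_sigma, Finset.mem_range] at hy
    exact ⟨t, x, hy.1, hy.2, hyi.symm⟩
  choose c pos hc hpos he using hmem
  refine ⟨c, pos, hc, hpos, ?_, ?_, ?_⟩
  · intro i j h1 h2
    apply e.injective
    apply Subtype.ext
    rw [he, he, h1, h2]
  · intro t x ht hx
    have hm : key ⟨t, x⟩ ∈ T := Finset.mem_image_of_mem _ (by simp [ht, hx])
    obtain ⟨i, hi⟩ := e.surjective ⟨_, hm⟩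
    refine ⟨i, ?_⟩
    have h1 := he i
    rw [hi] at h1
    have h2 := hkey h1
    simp only [Sigma.mk.injEq, heq_eq_eq] at h2
    exact ⟨h2.1.symm, h2.2.symm⟩
  · intro i j
    rw [← e.lt_iff_lt, ← Subtype.coe_lt_coe, he, he, Prod.Lex.toLex_lt_toLex]
    simp

namespace IsBlockDecomposition

variable {n z : ℕ} {lam : ℕ → ℕ} {c pos : Fin n → ℕ}

theorem card_colorClass (h : IsBlockDecomposition z lam c pos) {t : ℕ} (ht : t < z) :
    (colorClass c t).card = lam t := by
  have himage : (colorClass c t).image pos = Finset.range (lam t) := by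
    ext x
    simp only [Finset.mem_image, mem_colorClass, Finset.mem_range]
    constructor
    · rintro ⟨i, rfl, rfl⟩
      exact h.pos_lt i
    · exact h.exists_eq t x ht
  rw [← Finset.card_range (lam t), ← himage, Finset.card_image_of_injOn]
  intro i hi j hj hij
  rw [Finset.mem_coe, mem_colorClass] at hi hj
  exact h.ext i j (hi.trans hj.symm) hij

theorem exists_rotation (h : IsBlockDecomposition z lam c pos) :
    ∃ σ : Equiv.Perm (Fin n), ∀ i, c (σ i) = c i ∧ pos (σ i) = (pos i + 1) % lam (c i) := by
  have hex : ∀ i, ∃ j, c j = c i ∧ pos j = (pos i + 1) % lam (c i) := fun i =>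
    h.exists_eq _ _ (h.color_lt i) (Nat.mod_lt _ (Nat.zero_lt_of_lt (h.pos_lt i)))
  choose f hf using hex
  have hinj : Function.Injective f := by
    intro i j hij
    have hc : c i = c j := by rw [← (hf i).1, ← (hf j).1, hij]
    refine h.ext i j hc ?_
    have h1 : (pos i + 1) % lam (c i) = (pos j + 1) % lam (c i) := by
      rw [← (hf i).2, hij, (hf j).2, hc]
    have h2 : pos i ≡ pos j [MOD lam (c i)] := Nat.ModEq.add_right_cancel' 1 h1
    exact h2.eq_of_lt_of_lt (h.pos_lt i) (hc ▸ h.pos_lt j)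
  exact ⟨Equiv.ofBijective f (Finite.injective_iff_bijective.1 hinj), hf⟩

/-- Rotating each block, with any signs, makes the blocks the cycles. -/
theorem isCycleColoring_signedPerm (h : IsBlockDecomposition z lam c pos)
    {σ : Equiv.Perm (Fin n)}
    (hσ : ∀ i, c (σ i) = c i ∧ pos (σ i) = (pos i + 1) % lam (c i)) (g : Fin n → Bool) :
    IsCycleColoring (signedPerm σ g) c := by
  refine ⟨isSignedPerm_signedPerm σ g, fun i => (hσ i).1, fun i j hij => ?_⟩
  have hpow : ∀ m, c ((σ ^ m) i) = c i ∧ pos ((σ ^ m) i) = (pos i + m) % lam (c i) := by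
    intro m
    induction m with
    | zero => exact ⟨rfl, (Nat.mod_eq_of_lt (h.pos_lt i)).symm⟩
    | succ m ih =>
      rw [pow_succ', Equiv.Perm.mul_apply, (hσ _).1, (hσ _).2, ih.1, ih.2]
      exact ⟨rfl, by rw [Nat.mod_add_mod, add_assoc]⟩
  have hi := h.pos_lt i
  have hj := h.pos_lt j
  rw [← hij] at hj
  refine ⟨lam (c i) - pos i + pos j, ?_⟩
  rw [signedPerm_pow_fst]
  refine h.ext _ _ ((hpow _).1.trans hij) ?_
  rw [(hpow _).2, ← add_assoc, Nat.add_sub_cancel' hi.le, Nat.add_mod_left, Nat.mod_eq_of_lt hj]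

section Length

variable {ν : ℕ} {σ : Equiv.Perm (Fin n)} {g : Fin n → Bool}

theorem mem_shortInv (hg : ∀ i, g i = true ↔ c i < ν ∧ pos i + 1 = lam (c i)) (i : Fin n) :
    i ∈ shortInv (signedPerm σ g) ↔ c i < ν ∧ pos i + 1 = lam (c i) := by
  rw [← hg]
  simp [shortInv, signedPerm_apply]

theorem odd_card_iff (h : IsBlockDecomposition z lam c pos) (hpos : ∀ t < z, 1 ≤ lam t)
    (hg : ∀ i, g i = true ↔ c i < ν ∧ pos i + 1 = lam (c i)) {t : ℕ} (ht : t < z) :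
    t < ν ↔ Odd (colorClass c t ∩ shortInv (signedPerm σ g)).card := by
  constructor
  · intro htν
    obtain ⟨i, rfl, hi⟩ := h.exists_eq t (lam t - 1) ht (Nat.sub_lt (hpos t ht) one_pos)
    have hs : colorClass c (c i) ∩ shortInv (signedPerm σ g) = {i} := by
      ext j
      rw [Finset.mem_inter, mem_colorClass, mem_shortInv hg, Finset.mem_singleton]
      constructor
      · rintro ⟨hj, -, hj'⟩
        rw [hj] at hj'
        exact h.ext j i hj (by omega)
      · rintro rfl
        exact ⟨rfl, htν, by have := hpos _ ht; omega⟩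
    rw [hs]
    simp
  · intro hodd
    obtain ⟨i, hi⟩ := Finset.card_pos.1 hodd.pos
    rw [Finset.mem_inter, mem_colorClass, mem_shortInv hg] at hi
    exact hi.1 ▸ hi.2.1

theorem card_shortInv_le (h : IsBlockDecomposition z lam c pos)
    (hg : ∀ i, g i = true ↔ c i < ν ∧ pos i + 1 = lam (c i)) :
    (shortInv (signedPerm σ g)).card ≤ ν := by
  rw [← Finset.card_range ν]
  refine Finset.card_le_card_of_injOn c ?_ ?_
  · intro i hi
    simpa using ((mem_shortInv hg i).1 hi).1
  · intro i hi j hj hij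
    have h1 := ((mem_shortInv hg i).1 hi).2
    have h2 := ((mem_shortInv hg j).1 hj).2
    rw [← hij] at h2
    exact h.ext i j hij (by omega)

theorem longInv_of_color_eq (h : IsBlockDecomposition z lam c pos)
    (hσ : ∀ i, c (σ i) = c i ∧ pos (σ i) = (pos i + 1) % lam (c i))
    (hg : ∀ i, g i = true ↔ c i < ν ∧ pos i + 1 = lam (c i))
    {x : Fin n × Fin n × Bool} (hx : x ∈ longInv (signedPerm σ g)) (hc : c x.1 = c x.2.1) :
    pos x.1 + 1 < lam (c x.1) ∧ pos x.2.1 + 1 = lam (c x.1) ∧ x.2.2 = !g x.2.1 := by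
  obtain ⟨i, j, s⟩ := x
  obtain ⟨hij, hlead⟩ := mem_longInv.1 hx
  simp only at hij hc hlead ⊢
  have hpij : pos i < pos j := by
    rcases (h.lt_iff i j).1 hij with h1 | h1
    · omega
    · exact h1.2
  have hj := h.pos_lt j
  rw [← hc] at hj
  have hgi : g i = false := by
    rw [Bool.eq_false_iff, ne_eq, hg]
    omega
  have hσi : pos (σ i) = pos i + 1 := by rw [(hσ i).2, Nat.mod_eq_of_lt (by omega)]
  have hci := (hσ i).1
  have hcj := (hσ j).1
  unfold LeadSign at hlead
  simp only [signedPerm_apply, hgi, h.lt_iff, hci, hcj, hσi] at hlead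
  have hlast : pos j + 1 = lam (c i) := by
    by_contra hne
    have hσj : pos (σ j) = pos j + 1 := by
      rw [(hσ j).2, ← hc, Nat.mod_eq_of_lt (by omega)]
    rw [hσj] at hlead
    rcases hlead with hlead | hlead
    · simp at hlead
    · omega
  refine ⟨by omega, hlast, ?_⟩
  rcases hlead with hlead | hlead
  · simp at hlead
  · revert hlead
    cases s <;> cases g j <;> simp

theorem longInv_of_color_ne (h : IsBlockDecomposition z lam c pos)
    (hσ : ∀ i, c (σ i) = c i ∧ pos (σ i) = (pos i + 1) % lam (c i))
    (hg : ∀ i, g i = true ↔ c i < ν ∧ pos i + 1 = lam (c i))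
    {x : Fin n × Fin n × Bool} (hx : x ∈ longInv (signedPerm σ g)) (hc : c x.1 ≠ c x.2.1) :
    c x.2.1 < c x.1 ∧ c x.1 < ν ∧ pos x.1 + 1 = lam (c x.1) := by
  obtain ⟨i, j, s⟩ := x
  obtain ⟨hij, hlead⟩ := mem_longInv.1 hx
  simp only at hij hc hlead ⊢
  have hlt : c j < c i := by
    rcases (h.lt_iff i j).1 hij with h1 | h1
    · exact h1
    · exact absurd h1.1 hc
  refine ⟨hlt, (hg i).1 ?_⟩
  unfold LeadSign at hlead
  simp only [signedPerm_apply, h.lt_iff, (hσ i).1, (hσ j).1] at hlead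
  rcases hlead with hlead | hlead
  · simpa using hlead.2
  · omega

theorem card_longInv_le (h : IsBlockDecomposition z lam c pos)
    (hσ : ∀ i, c (σ i) = c i ∧ pos (σ i) = (pos i + 1) % lam (c i))
    (hg : ∀ i, g i = true ↔ c i < ν ∧ pos i + 1 = lam (c i)) :
    (longInv (signedPerm σ g)).card ≤ ∑ t ∈ Finset.range z, (lam t - 1) +
      ∑ u ∈ Finset.range ν, ∑ t ∈ Finset.range u, 2 * lam t := by
  rw [← Finset.card_filter_add_card_filter_not (s := longInv (signedPerm σ g))
    (fun x => c x.1 = c x.2.1)]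
  refine add_le_add ?_ ?_
  · rw [Finset.card_eq_sum_card_fiberwise (f := fun x => c x.1) (t := Finset.range z)
      (fun x _ => by simpa using h.color_lt x.1)]
    refine Finset.sum_le_sum fun t _ => ?_
    rw [← Finset.card_range (lam t - 1)]
    refine Finset.card_le_card_of_injOn (fun x => pos x.1) ?_ ?_
    · intro x hx
      simp only [Finset.coe_filter, Finset.mem_filter, Set.mem_ofPred_eq] at hx
      obtain ⟨⟨hx, hc⟩, rfl⟩ := hx
      have := (h.longInv_of_color_eq hσ hg hx hc).1
      simp only [Finset.coe_range, Set.mem_Iio]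
      omega
    · rintro ⟨i, j, s⟩ hx ⟨i', j', s'⟩ hx' heq
      simp only [Finset.coe_filter, Finset.mem_filter, Set.mem_ofPred_eq] at hx hx' heq
      obtain ⟨⟨hx, hc⟩, rfl⟩ := hx
      obtain ⟨⟨hx', hc'⟩, ht⟩ := hx'
      have h1 := h.longInv_of_color_eq hσ hg hx hc
      have h2 := h.longInv_of_color_eq hσ hg hx' hc'
      simp only at h1 h2
      rw [ht] at h2
      obtain rfl := h.ext i i' ht.symm heq
      obtain rfl := h.ext j j' (hc.symm.trans hc') (by omega)
      rw [h1.2.2, h2.2.2]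
  · rw [Finset.sum_sigma', Finset.card_eq_sum_card_fiberwise
      (f := fun x => (⟨c x.1, c x.2.1⟩ : Σ _ : ℕ, ℕ))
      (t := (Finset.range ν).sigma (fun u => Finset.range u))]
    · refine Finset.sum_le_sum fun ⟨u, t⟩ _ => ?_
      have hcard : 2 * lam t = (Finset.range (lam t) ×ˢ (Finset.univ : Finset Bool)).card := by
        rw [Finset.card_product, Finset.card_range, Finset.card_univ, Fintype.card_bool, mul_comm]
      rw [hcard]
      refine Finset.card_le_card_of_injOn (fun x => (pos x.2.1, x.2.2)) ?_ ?_
      · intro x hx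
        simp only [Finset.coe_filter, Finset.mem_filter, Set.mem_ofPred_eq, Sigma.mk.injEq,
          heq_eq_eq] at hx
        obtain ⟨-, -, rfl⟩ := hx
        simpa using h.pos_lt x.2.1
      · rintro ⟨i, j, s⟩ hx ⟨i', j', s'⟩ hx' heq
        simp only [Finset.coe_filter, Finset.mem_filter, Set.mem_ofPred_eq, Sigma.mk.injEq,
          heq_eq_eq, Prod.mk.injEq] at hx hx' heq
        obtain ⟨⟨hx, hc⟩, rfl, rfl⟩ := hx
        obtain ⟨⟨hx', hc'⟩, hu, ht⟩ := hx'
        have h1 := h.longInv_of_color_ne hσ hg hx hc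
        have h2 := h.longInv_of_color_ne hσ hg hx' hc'
        simp only at h1 h2
        rw [hu] at h2
        obtain ⟨heq, rfl⟩ := heq
        obtain rfl := h.ext i i' hu.symm (by omega)
        obtain rfl := h.ext j j' ht.symm heq
        rfl
    · intro x hx
      simp only [Finset.coe_filter, Set.mem_ofPred_eq] at hx
      have := h.longInv_of_color_ne hσ hg hx.1 hx.2
      simpa using ⟨this.2.1, this.1⟩

end Length

end IsBlockDecomposition

/-- The minimal length in the conjugacy class of `B_n` with signed cycle type
given by cycle lengths `lam 0, …, lam (z-1)`, of which the first `ν` are the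
negative cycle lengths, sorted increasingly (the paper's `λ_i` is `lam (i-1)`),
is `n + ν - z + 2·∑_{i=1}^{ν-1} (ν-i) λ_i`. -/
theorem stmt9 {n z ν : ℕ} (hνz : ν ≤ z)
    (lam : ℕ → ℕ)
    (hnonempty : ∀ t, t < z → 1 ≤ lam t)
    (hsum : ∑ t ∈ Finset.range z, lam t = n)
    (hsort : ∀ s t, s ≤ t → t < ν → lam s ≤ lam t) :
    IsLeast
      {L : ℕ | ∃ w : Equiv.Perm (Fin n × Bool), IsSignedPerm w ∧
        (∃ c : Fin n → ℕ, (∀ i, c i < z) ∧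
          (∀ i : Fin n, c ((w (i, false)).1) = c i) ∧
          (∀ i j : Fin n, c i = c j → ∃ m : ℕ, ((w ^ m) (i, false)).1 = j) ∧
          (∀ t, t < z → lam t = Set.ncard {i : Fin n | c i = t}) ∧
          (∀ t, t < z →
            (t < ν ↔ Odd (Set.ncard {i : Fin n | c i = t ∧ (w (i, false)).2 = true})))) ∧
        L = BLen w}
      (n + ν - z + 2 * ∑ j ∈ Finset.range (ν - 1), (ν - 1 - j) * lam j) := by
  have hvalue : n + ν - z + 2 * ∑ j ∈ Finset.range (ν - 1), (ν - 1 - j) * lam j =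
      ν + (∑ t ∈ Finset.range z, (lam t - 1) +
        ∑ u ∈ Finset.range ν, ∑ t ∈ Finset.range u, 2 * lam t) := by
    have h1 := sum_sub_one_add hnonempty
    simp only [← Finset.mul_sum, sum_range_sum_range_eq]
    omega
  have hlower : ∀ (w : Equiv.Perm (Fin n × Bool)) (c : Fin n → ℕ), IsCycleColoring w c →
      (∀ t, t < z → (colorClass c t).card = lam t) →
      (∀ t, t < z → (t < ν ↔ Odd (colorClass c t ∩ shortInv w).card)) →
      n + ν - z + 2 * ∑ j ∈ Finset.range (ν - 1), (ν - 1 - j) * lam j ≤ BLen w := by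
    intro w c h hcard hodd
    have hodd' : ∀ t < ν, Odd (colorClass c t ∩ shortInv w).card := fun t ht =>
      (hodd t (ht.trans_le hνz)).1 ht
    rw [hvalue, BLen_eq_card h.signed]
    refine add_le_add (le_card_shortInv_of_odd hodd') (le_trans (le_of_eq ?_)
      (h.sum_le_card_longInv z hodd' fun s t hst ht => ?_))
    · congr 1
      · exact Finset.sum_congr rfl fun t ht => by rw [hcard t (Finset.mem_range.1 ht)]
      · refine Finset.sum_congr rfl fun u hu => Finset.sum_congr rfl fun t ht => ?_
        rw [hcard t (by simp only [Finset.mem_range] at hu ht; omega)]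
    · rw [hcard s (by omega), hcard t (by omega)]
      exact hsort s t hst ht
  constructor
  · obtain ⟨c, pos, h⟩ := exists_isBlockDecomposition hsum
    obtain ⟨σ, hσ⟩ := h.exists_rotation
    let g : Fin n → Bool := fun i => decide (c i < ν ∧ pos i + 1 = lam (c i))
    have hg : ∀ i, g i = true ↔ c i < ν ∧ pos i + 1 = lam (c i) := fun i => by simp [g]
    have hcol := h.isCycleColoring_signedPerm hσ g
    have hcard : ∀ t, t < z → (colorClass c t).card = lam t := fun t => h.card_colorClass
    have hodd : ∀ t, t < z → (t < ν ↔ Odd (colorClass c t ∩ shortInv (signedPerm σ g)).card) :=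
      fun t => h.odd_card_iff hnonempty hg
    refine ⟨signedPerm σ g, hcol.signed, ⟨c, h.color_lt, hcol.color_apply, hcol.transitive,
      fun t ht => by rw [ncard_color_eq, hcard t ht],
      fun t ht => by rw [ncard_color_inter_eq]; exact hodd t ht⟩, ?_⟩
    refine le_antisymm (hlower _ c hcol hcard hodd) ?_
    rw [hvalue, BLen_eq_card hcol.signed]
    exact add_le_add (h.card_shortInv_le hg) (h.card_longInv_le hσ hg)
  · rintro _ ⟨w, hw, ⟨c, -, hc, htrans, hcard, hodd⟩, rfl⟩
    refine hlower w c ⟨hw, hc, htrans⟩ (fun t ht => ?_) (fun t ht => ?_)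
    · rw [hcard t ht, ncard_color_eq]
    · rw [hodd t ht, ncard_color_inter_eq]
end

section
/- In every finite dihedral group, viewed as a Coxeter group with length function ℓ, every element w can be written as w = στ with σ, τ involutions or the identity and ℓ(w) = ℓ(σ) + ℓ(τ). That is, every element of a dihedral group has excess zero. -/
namespace CoxeterSystem

variable {W : Type*} [Group W] {M : CoxeterMatrix (Fin 2)} (cs : CoxeterSystem M W)

theorem wordProd_mem_zpowers (ω : List (Fin 2)) :
    (Even ω.length → cs.wordProd ω ∈ Subgroup.zpowers (cs.simple 0 * cs.simple 1)) ∧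
    (¬ Even ω.length →
      cs.simple 0 * cs.wordProd ω ∈ Subgroup.zpowers (cs.simple 0 * cs.simple 1)) := by
  induction ω with
  | nil => simp
  | cons i ω ih =>
    have hr := Subgroup.mem_zpowers (cs.simple 0 * cs.simple 1)
    rw [List.length_cons, Nat.even_add_one, not_not, wordProd_cons]
    refine ⟨fun h => ?_, fun h => ?_⟩
    · fin_cases i
      · exact ih.2 h
      · have := mul_mem (inv_mem hr) (ih.2 h)
        simpa [mul_assoc] using this
    · fin_cases i
      · simpa using ih.1 h
      · simpa [mul_assoc] using mul_mem hr (ih.1 h)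

theorem mul_self_eq_one_of_odd_length {w : W} (hw : ¬ Even (cs.length w)) : w * w = 1 := by
  obtain ⟨ω, hω, rfl⟩ := cs.exists_isReduced w
  rw [hω.eq] at hw
  obtain ⟨k, hk⟩ := (cs.wordProd_mem_zpowers ω).2 hw
  have hconj : cs.simple 0 * (cs.simple 0 * cs.simple 1) ^ k * (cs.simple 0)⁻¹ =
      ((cs.simple 0 * cs.simple 1) ^ k)⁻¹ := by
    rw [← conj_zpow, ← inv_zpow]
    simp
  have hk' : cs.wordProd ω = cs.simple 0 * (cs.simple 0 * cs.simple 1) ^ k := by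
    simp only at hk
    rw [hk, simple_mul_simple_cancel_left]
  rw [inv_simple] at hconj
  rw [hk', ← mul_assoc, hconj, inv_mul_cancel]

end CoxeterSystem

/-- In a finite dihedral group, i.e. a finite rank-2 Coxeter group, every
element is a product of two involutions (or identity) whose lengths add up to
its length; that is, every element has excess zero. -/
theorem stmt15 {W : Type*} [Group W] [Finite W]
    (M : CoxeterMatrix (Fin 2)) (cs : CoxeterSystem M W) (w : W) :
    ∃ σ τ : W, σ * σ = 1 ∧ τ * τ = 1 ∧ w = σ * τ ∧
      cs.length w = cs.length σ + cs.length τ := by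
  by_cases hw : Even (cs.length w)
  · by_cases h1 : w = 1
    · exact ⟨1, 1, by simp [h1]⟩
    · obtain ⟨i, hi⟩ := cs.exists_leftDescent_of_ne_one h1
      rw [cs.isLeftDescent_iff] at hi
      refine ⟨cs.simple i, cs.simple i * w, cs.simple_mul_simple_self i,
        cs.mul_self_eq_one_of_odd_length ?_, by simp, by rw [cs.length_simple, ← hi, add_comm]⟩
      rwa [← hi, Nat.even_add_one] at hw
  · exact ⟨w, 1, cs.mul_self_eq_one_of_odd_length hw, by simp⟩
end
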